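/- Fix real λ and real η and set v₀ = −λ² − λ − η². For ρ₀ > 0 define ε = v₀/(2ρ₀), δ = ε − η·ln(1 + ε/ρ₀), and ρ = ρ₀ + ε. Then sin(δ)·(1 + η/(2ρ)) + cos(δ)·(−v₀/(2ρ)) = O(ρ₀^{−2}) as ρ₀ → ∞. -/

import Mathlib

open Real Filter Asymptotics

open scoped Topology

theorem Real.isBigO_sin_sub_self_sq :
    (fun x : ℝ => Real.sin x - x) =O[𝓝 0] fun x => x ^ 2 := by
  refine IsBigO.of_bound 1 ?_
  filter_upwards [Metric.closedBall_mem_nhds (0 : ℝ) one_pos] with x hx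
  have hx1 : |x| ≤ 1 := by simpa using hx
  have h := abs_le.mp (Real.sin_bound hx1)
  have h0 := abs_nonneg x
  have h3 : |x| ^ 3 ≤ |x| ^ 2 := pow_le_pow_of_le_one h0 hx1 (by norm_num)
  have h5 : |x| ^ 5 ≤ |x| ^ 2 := pow_le_pow_of_le_one h0 hx1 (by norm_num)
  have hc : |x ^ 3| ≤ |x| ^ 2 := by rwa [abs_pow]
  have hc' := abs_le.mp hc
  rw [Real.norm_eq_abs, norm_pow, Real.norm_eq_abs, one_mul]
  exact abs_le.mpr ⟨by linarith [h.1, hc'.2, sq_nonneg |x|],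
    by linarith [h.2, hc'.1, sq_nonneg |x|]⟩

theorem Real.isBigO_log_one_add_self :
    (fun x : ℝ => Real.log (1 + x)) =O[𝓝 0] fun x => x := by
  have hd : DifferentiableAt ℝ (fun x : ℝ => Real.log (1 + x)) 0 :=
    DifferentiableAt.log (by fun_prop) (by norm_num)
  simpa using hd.isBigO_sub

theorem Real.isBigO_sin_self : (fun x : ℝ => Real.sin x) =O[𝓝 0] fun x => x := by
  simpa using (Real.differentiableAt_sin (x := 0)).isBigO_sub

theorem Real.isBigO_one_sub_cos_self :
    (fun x : ℝ => 1 - Real.cos x) =O[𝓝 0] fun x => x := by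
  simpa using (Real.differentiableAt_cos (x := 0)).isBigO_sub.neg_left

/-- with v₀ = −λ²−λ−η², ε = v₀/(2ρ₀), δ = ε − η ln(1+ε/ρ₀), ρ = ρ₀+ε,
the truncated zero equation sin(δ)(1 + η/(2ρ)) + cos(δ)(−v₀/(2ρ)) is O(ρ₀⁻²). -/
theorem coulomb_mcmahon_first_order (lam η v0 : ℝ)
    (hv0 : v0 = -lam ^ 2 - lam - η ^ 2) :
    (fun ρ₀ : ℝ =>
        let ε : ℝ := v0 / (2 * ρ₀)
        let δ : ℝ := ε - η * Real.log (1 + ε / ρ₀)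
        let ρ : ℝ := ρ₀ + ε
        Real.sin δ * (1 + η / (2 * ρ)) + Real.cos δ * (-v0 / (2 * ρ)))
      =O[atTop] fun ρ₀ : ℝ => ρ₀ ^ (-2 : ℤ) := by
  have hsq : (fun t : ℝ => t ^ (-2 : ℤ)) = fun t => t⁻¹ ^ 2 := by
    funext t
    rw [zpow_neg, inv_pow]
    norm_cast
  rw [hsq]
  let ε : ℝ → ℝ := fun t => v0 / (2 * t)
  let L : ℝ → ℝ := fun t => Real.log (1 + ε t / t)
  let δ : ℝ → ℝ := fun t => ε t - η * L t
  let r : ℝ → ℝ := fun t => (t + ε t)⁻¹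
  have hinv : Tendsto (fun t : ℝ => t⁻¹) atTop (𝓝 0) := tendsto_inv_atTop_zero
  have hε : ε =O[atTop] fun t => t⁻¹ := by
    have : ε = fun t => v0 / 2 * t⁻¹ := by
      funext t
      simp only [ε, div_eq_mul_inv, mul_inv]
      ring
    rw [this]
    exact (isBigO_refl _ _).const_mul_left _
  have hε0 : Tendsto ε atTop (𝓝 0) := hε.trans_tendsto hinv
  have hεt : (fun t => ε t / t) =O[atTop] fun t => t⁻¹ ^ 2 := by
    simpa only [div_eq_mul_inv, sq] using hε.mul (isBigO_refl (fun t : ℝ => t⁻¹) atTop)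
  have hεt0 : Tendsto (fun t => ε t / t) atTop (𝓝 0) :=
    hεt.trans_tendsto (by simpa using hinv.pow 2)
  have hL : L =O[atTop] fun t => t⁻¹ ^ 2 :=
    (Real.isBigO_log_one_add_self.comp_tendsto hεt0).trans hεt
  have hsq1 : (fun t : ℝ => t⁻¹ ^ 2) =O[atTop] fun t => t⁻¹ := by
    simpa [sq] using (isBigO_refl (fun t : ℝ => t⁻¹) atTop).mul (hinv.isBigO_one ℝ)
  have hδ : δ =O[atTop] fun t => t⁻¹ := hε.sub ((hL.const_mul_left η).trans hsq1)
  have hδ0 : Tendsto δ atTop (𝓝 0) := hδ.trans_tendsto hinv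
  have hρ : ∀ᶠ t in atTop, t / 2 ≤ t + ε t := by
    filter_upwards [hε0.eventually (lt_mem_nhds (show (-1 : ℝ) < 0 by norm_num)),
      eventually_ge_atTop 2] with t h1 h2
    linarith
  have hr : r =O[atTop] fun t => t⁻¹ := by
    refine IsBigO.of_bound 2 ?_
    filter_upwards [hρ, eventually_gt_atTop 0] with t h1 h2
    have h3 : 0 < t + ε t := by linarith
    rw [Real.norm_of_nonneg (inv_pos.mpr h3).le, Real.norm_of_nonneg (inv_pos.mpr h2).le]
    calc (t + ε t)⁻¹ ≤ (t / 2)⁻¹ := inv_anti₀ (by linarith) h1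
      _ = 2 * t⁻¹ := by rw [inv_div, div_eq_mul_inv]
  have hsin : (fun t => Real.sin (δ t) - δ t) =O[atTop] fun t => t⁻¹ ^ 2 :=
    (Real.isBigO_sin_sub_self_sq.comp_tendsto hδ0).trans (hδ.pow 2)
  have hsinr : (fun t => Real.sin (δ t) * r t) =O[atTop] fun t => t⁻¹ ^ 2 := by
    simpa only [sq, Function.comp_apply] using
      ((Real.isBigO_sin_self.comp_tendsto hδ0).trans hδ).mul hr
  have hcosr : (fun t => (1 - Real.cos (δ t)) * r t) =O[atTop] fun t => t⁻¹ ^ 2 := by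
    simpa only [sq, Function.comp_apply] using
      ((Real.isBigO_one_sub_cos_self.comp_tendsto hδ0).trans hδ).mul hr
  have hdiff : (fun t => ε t / t * r t) =O[atTop] fun t => t⁻¹ ^ 2 := by
    simpa using hεt.mul ((hr.trans_tendsto hinv).isBigO_one ℝ)
  refine ((((hsin.sub (hL.const_mul_left η)).add (hsinr.const_mul_left (η / 2))).add
    (hcosr.const_mul_left (v0 / 2))).add (hdiff.const_mul_left (v0 / 2))).congr' ?_ .rfl
  filter_upwards [hρ, eventually_gt_atTop 0] with t h1 h2
  have h3 : t + ε t ≠ 0 := by linarith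
  have hrt : ε t / t * r t = t⁻¹ - r t := by
    simp only [r]
    field_simp
    ring
  have hεv : ε t = v0 / 2 * t⁻¹ := by
    simp only [ε]
    field_simp
  have hη : ∀ c : ℝ, c / (2 * (t + ε t)) = c / 2 * r t := by
    intro c
    simp only [r]
    field_simp
  change _ = Real.sin (δ t) * (1 + η / (2 * (t + ε t))) +
    Real.cos (δ t) * (-v0 / (2 * (t + ε t)))
  rw [hη, hη, hrt]
  have hδt : δ t = v0 / 2 * t⁻¹ - η * L t := by rw [← hεv]
  linear_combination -hδt
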